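/- arXiv:2402.05507 — 2 statements merged into one kernel-verified Lean document; each statement's English description precedes it below -/
import Mathlib

section
/- (Mysovskih) Let μ be a probability measure on ℝ with finite raw moments μ_i = ∫ x^i dμ for i = 0, …, 2p, and let M be the (p+1)×(p+1) Hankel matrix M_{jk} = μ_{j+k}. Suppose M = Rᵀ R with R upper triangular and invertible, and define polynomials ψ_j(x) = Σ_{k=0}^{p} (R^{-1})_{kj} x^k for j = 0, …, p. Then the ψ_j form an orthonormal system in L²(μ): ∫ ψ_i ψ_j dμ = δ_{ij}. -/
open MeasureTheory Matrix

/-- The integral of a product of two polynomials is the bilinear form of the moment matrix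
evaluated at their coefficient vectors. -/
theorem integral_sum_pow_mul_sum_pow {n : ℕ} {μ : Measure ℝ}
    (hmom : ∀ k l : Fin n, Integrable (fun x : ℝ => x ^ ((k : ℕ) + (l : ℕ))) μ)
    (a b : Fin n → ℝ) :
    ∫ x, (∑ k, a k * x ^ (k : ℕ)) * (∑ l : Fin n, b l * x ^ (l : ℕ)) ∂μ =
      ∑ k : Fin n, ∑ l : Fin n, a k * (∫ x, x ^ ((k : ℕ) + (l : ℕ)) ∂μ) * b l := by
  have hexpand (x : ℝ) : (∑ k, a k * x ^ (k : ℕ)) * (∑ l : Fin n, b l * x ^ (l : ℕ)) =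
      ∑ k : Fin n, ∑ l : Fin n, a k * x ^ ((k : ℕ) + (l : ℕ)) * b l := by
    rw [Finset.sum_mul_sum]
    refine Finset.sum_congr rfl fun k _ => Finset.sum_congr rfl fun l _ => ?_
    ring
  have hint (k l : Fin n) :
      Integrable (fun x : ℝ => a k * x ^ ((k : ℕ) + (l : ℕ)) * b l) μ :=
    ((hmom k l).const_mul _).mul_const _
  simp_rw [hexpand]
  rw [integral_finsetSum _ fun k _ => integrable_finsetSum _ fun l _ => hint k l]
  refine Finset.sum_congr rfl fun k _ => ?_
  rw [integral_finsetSum _ fun l _ => hint k l]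
  simp_rw [integral_mul_const, integral_const_mul]

/-- (Mysovskih) If the Hankel moment matrix factors as `M = Rᵀ * R` with `R`
upper triangular and invertible, then the polynomials
`ψ j (x) = ∑ k, (R⁻¹) k j * x ^ k` form an orthonormal system in `L²(μ)`. -/
theorem mysovskih_orthonormal (p : ℕ) (μ : Measure ℝ)
    [IsProbabilityMeasure μ]
    (hmom : ∀ i ≤ 2 * p, Integrable (fun x : ℝ => x ^ i) μ)
    (R : Matrix (Fin (p + 1)) (Fin (p + 1)) ℝ)
    (hR : R.BlockTriangular id) (hRunit : IsUnit R.det)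
    (hM : ∀ j k : Fin (p + 1), ∫ x, x ^ ((j : ℕ) + (k : ℕ)) ∂μ = (Rᵀ * R) j k) :
    ∀ i j : Fin (p + 1),
      ∫ x, (∑ k, R⁻¹ k i * x ^ (k : ℕ)) * (∑ k, R⁻¹ k j * x ^ (k : ℕ)) ∂μ =
        if i = j then 1 else 0 := by
  intro i j
  have hgram : (R⁻¹)ᵀ * (Rᵀ * R) * R⁻¹ = 1 := by
    rw [← Matrix.mul_assoc, ← Matrix.transpose_mul, Matrix.mul_nonsing_inv R hRunit,
      Matrix.transpose_one, Matrix.one_mul, Matrix.mul_nonsing_inv R hRunit]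
  rw [integral_sum_pow_mul_sum_pow (fun k l => hmom _ (by omega)), ← Matrix.one_apply, ← hgram,
    Matrix.mul_apply, Finset.sum_comm]
  refine Finset.sum_congr rfl fun l _ => ?_
  rw [Matrix.mul_apply, Finset.sum_mul]
  simp_rw [hM, Matrix.transpose_apply]
end

section
/- Let K : ℝ → Matrix(Fin n, Fin n, ℝ) be differentiable at t₀ with derivative K'(t₀), suppose K(t₀) is invertible and symmetric, and let f ∈ ℝⁿ. Define u(t) = K(t)^{-1} f and the compliance C(t) = fᵀ u(t). Then C is differentiable at t₀ with C'(t₀) = − u(t₀)ᵀ K'(t₀) u(t₀). -/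
open Matrix

open scoped Matrix.Norms.Operator in
/-- The derivative of the inverse of a matrix-valued curve, read entrywise. -/
theorem hasDerivAt_matrix_inv_apply {ι : Type*} [Fintype ι] [DecidableEq ι]
    {K : ℝ → Matrix ι ι ℝ} {K' : Matrix ι ι ℝ} {t₀ : ℝ}
    (hK : ∀ i j, HasDerivAt (fun t => K t i j) (K' i j) t₀)
    (hinv : IsUnit (K t₀).det) (i j : ι) :
    HasDerivAt (fun t => (K t)⁻¹ i j) ((-((K t₀)⁻¹ * K' * (K t₀)⁻¹)) i j) t₀ := by
  have hderiv : HasDerivAt K K' t₀ :=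
    hasDerivAt_pi.2 fun i => hasDerivAt_pi.2 fun j => hK i j
  obtain ⟨x, hx⟩ := (isUnit_iff_isUnit_det _).2 hinv
  have hx_inv : (K t₀)⁻¹ = ↑x⁻¹ := by rw [← hx, coe_units_inv]
  have hring := hasFDerivAt_ringInverse (𝕜 := ℝ) x
  rw [hx] at hring
  have hcomp := hring.comp_hasDerivAt t₀ hderiv
  have hentry := hasDerivAt_pi.1 (hasDerivAt_pi.1 hcomp i) j
  rw [hx_inv]
  simp only [nonsing_inv_eq_ringInverse]
  exact hentry

/-- Adjoint sensitivity of the compliance: if `u(t) = K(t)⁻¹ f` and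
`C(t) = fᵀ u(t)` with `K(t₀)` invertible and symmetric, then
`C'(t₀) = - u(t₀)ᵀ K'(t₀) u(t₀)`. -/
theorem compliance_sensitivity (n : ℕ)
    (K : ℝ → Matrix (Fin n) (Fin n) ℝ)
    (K' : Matrix (Fin n) (Fin n) ℝ) (t₀ : ℝ)
    (hK : ∀ i j, HasDerivAt (fun t => K t i j) (K' i j) t₀)
    (hinv : IsUnit (K t₀).det) (hsym : (K t₀)ᵀ = K t₀)
    (f : Fin n → ℝ) :
    HasDerivAt (fun t => f ⬝ᵥ ((K t)⁻¹).mulVec f)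
      (-(((K t₀)⁻¹.mulVec f) ⬝ᵥ K'.mulVec ((K t₀)⁻¹.mulVec f))) t₀ := by
  have hC : HasDerivAt (fun t => f ⬝ᵥ ((K t)⁻¹).mulVec f)
      (f ⬝ᵥ (-((K t₀)⁻¹ * K' * (K t₀)⁻¹)).mulVec f) t₀ := by
    simp only [mulVec, dotProduct]
    exact HasDerivAt.fun_sum fun i _ => (HasDerivAt.fun_sum fun j _ =>
      (hasDerivAt_matrix_inv_apply hK hinv i j).mul_const (f j)).const_mul (f i)
  have hu : f ᵥ* (K t₀)⁻¹ = (K t₀)⁻¹ *ᵥ f := by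
    rw [← mulVec_transpose, transpose_nonsing_inv, hsym]
  rwa [neg_mulVec, dotProduct_neg, ← mulVec_mulVec, ← mulVec_mulVec, dotProduct_mulVec, hu] at hC
end
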